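/- Let 0<q<1 be real, let h̃1,h̃2,l̃1,l̃2,α̃1,α̃2,β̃,μ0,α1 be real numbers and t1,t2 nonzero complex numbers. Set χ = (h̃1+h̃2−l̃1−l̃2+α̃1−α̃2−β̃)/2, ν = μ0+α1−α̃2, μ = μ0+χ+1, β = −β̃−χ, α2 = α1+α̃1−α̃2−χ, l_i = h̃_i+μ0 and h_i = l̃_i+μ0+χ for i=1,2. Let P be a function of two nonzero complex variables satisfying, for all nonzero x,s: P(x,s/q) = P(qx,s), P(x,qs) = P(x/q,s), (x−q^{μ0−1}s)P(x,s/q) = (x−q^{μ−1}s)P(x,s), and (x−q^{μ}s)P(x,qs) = (x−q^{μ0}s)P(x,s). Define Φ(x,s) = x^{−α1} s^{1+χ−α̃1} P(x,s). Then for all nonzero x,s with x ≠ q^{μ0−1}s and x ≠ q^{μ}s, applying A⟨4⟩(x; h1,h2,l1,l2,α1,α2,β) to Φ in x equals q^{ν} times applying A⟨4⟩(s; h̃1,h̃2,l̃1,l̃2,α̃1,α̃2,β̃) to Φ in s. -/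

import Mathlib

open Filter Topology

/-- The infinite q-Pochhammer symbol `(a;q)_∞ = ∏_{j=0}^∞ (1 - q^j a)`. -/
noncomputable def qPochInf (q : ℝ) (a : ℂ) : ℂ := ∏' j : ℕ, (1 - (q : ℂ) ^ j * a)

/-- `q^r` for a real exponent `r`, using the principal branch of the complex power. -/
noncomputable def qpow (q : ℝ) (r : ℝ) : ℂ := (q : ℂ) ^ (r : ℂ)

/-- The fourth degenerate Ruijsenaars–van Diejen operator `A⟨4⟩` applied to `g` at `x`. -/
noncomputable def A4 (q : ℝ) (t1 t2 : ℂ) (h1 h2 l1 l2 a1 a2 b : ℝ) (g : ℂ → ℂ) (x : ℂ) : ℂ :=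
  x⁻¹ * (x - qpow q (h1 + 1/2) * t1) * (x - qpow q (h2 + 1/2) * t2) * g (x / (q : ℂ))
    + qpow q (a1 + a2) * x⁻¹ * (x - qpow q (l1 - 1/2) * t1) * (x - qpow q (l2 - 1/2) * t2) *
        g ((q : ℂ) * x)
    - ((qpow q a1 + qpow q a2) * x
        + qpow q ((h1 + h2 + l1 + l2 + a1 + a2) / 2) * (qpow q (b / 2) + qpow q (-(b / 2))) *
            t1 * t2 * x⁻¹) * g x

theorem qpow_add {q : ℝ} (hq : 0 < q) (r r' : ℝ) : qpow q (r + r') = qpow q r * qpow q r' := by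
  unfold qpow
  rw [Complex.ofReal_add, Complex.cpow_add _ _ (by exact_mod_cast hq.ne')]

theorem qpow_neg (q r : ℝ) : qpow q (-r) = (qpow q r)⁻¹ := by
  unfold qpow
  rw [Complex.ofReal_neg, Complex.cpow_neg]

theorem qpow_sub {q : ℝ} (hq : 0 < q) (r r' : ℝ) : qpow q (r - r') = qpow q r / qpow q r' := by
  rw [sub_eq_add_neg, qpow_add hq, qpow_neg, div_eq_mul_inv]

theorem qpow_one (q : ℝ) : qpow q 1 = q := by
  simp [qpow]

theorem qpow_half_sq {q : ℝ} (hq : 0 < q) : qpow q (1 / 2) ^ 2 = q := by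
  rw [sq, ← qpow_add hq, add_halves, qpow_one]

theorem qpow_ne_zero {q : ℝ} (hq : 0 < q) (r : ℝ) : qpow q r ≠ 0 := by
  unfold qpow
  rw [Complex.cpow_ne_zero_iff]
  exact Or.inl (by exact_mod_cast hq.ne')

theorem ofReal_mul_cpow {q : ℝ} (hq : 0 < q) {x : ℂ} (hx : x ≠ 0) (r : ℝ) :
    ((q : ℂ) * x) ^ (r : ℂ) = qpow q r * x ^ (r : ℂ) := by
  have hq' : (q : ℂ) ≠ 0 := by exact_mod_cast hq.ne'
  unfold qpow
  rw [Complex.cpow_def_of_ne_zero (mul_ne_zero hq' hx), Complex.cpow_def_of_ne_zero hq',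
    Complex.cpow_def_of_ne_zero hx, Complex.log_ofReal_mul hq hx, Complex.ofReal_log hq.le,
    add_mul, Complex.exp_add]

theorem div_ofReal_cpow {q : ℝ} (hq : 0 < q) {x : ℂ} (hx : x ≠ 0) (r : ℝ) :
    (x / (q : ℂ)) ^ (r : ℂ) = (qpow q r)⁻¹ * x ^ (r : ℂ) := by
  have hq' : (q : ℂ) ≠ 0 := by exact_mod_cast hq.ne'
  have h := ofReal_mul_cpow hq (div_ne_zero hx hq') r
  rw [mul_div_cancel₀ _ hq'] at h
  rw [h, inv_mul_cancel_left₀ (qpow_ne_zero hq r)]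

theorem stmt1 (q : ℝ) (hq0 : 0 < q) (hq1 : q < 1)
    (th1 th2 tl1 tl2 ta1 ta2 tb μ0 a1 : ℝ) (t1 t2 : ℂ) (ht1 : t1 ≠ 0) (ht2 : t2 ≠ 0)
    (χ ν μ b a2 l1 l2 h1 h2 : ℝ)
    (hχ : χ = (th1 + th2 - tl1 - tl2 + ta1 - ta2 - tb) / 2)
    (hν : ν = μ0 + a1 - ta2)
    (hμ : μ = μ0 + χ + 1)
    (hb : b = -tb - χ)
    (ha2 : a2 = a1 + ta1 - ta2 - χ)
    (hl1 : l1 = th1 + μ0) (hl2 : l2 = th2 + μ0)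
    (hh1 : h1 = tl1 + μ0 + χ) (hh2 : h2 = tl2 + μ0 + χ)
    (P : ℂ → ℂ → ℂ)
    (hPa : ∀ x s : ℂ, x ≠ 0 → s ≠ 0 → P x (s / (q : ℂ)) = P ((q : ℂ) * x) s)
    (hPb : ∀ x s : ℂ, x ≠ 0 → s ≠ 0 → P x ((q : ℂ) * s) = P (x / (q : ℂ)) s)
    (hPc : ∀ x s : ℂ, x ≠ 0 → s ≠ 0 →
      (x - qpow q (μ0 - 1) * s) * P x (s / (q : ℂ)) = (x - qpow q (μ - 1) * s) * P x s)
    (hPd : ∀ x s : ℂ, x ≠ 0 → s ≠ 0 →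
      (x - qpow q μ * s) * P x ((q : ℂ) * s) = (x - qpow q μ0 * s) * P x s)
    (Φ : ℂ → ℂ → ℂ)
    (hΦ : ∀ x s : ℂ, Φ x s = x ^ ((-a1 : ℝ) : ℂ) * s ^ ((1 + χ - ta1 : ℝ) : ℂ) * P x s)
    (x s : ℂ) (hx : x ≠ 0) (hs : s ≠ 0)
    (hres1 : x ≠ qpow q (μ0 - 1) * s) (hres2 : x ≠ qpow q μ * s) :
    A4 q t1 t2 h1 h2 l1 l2 a1 a2 b (fun y => Φ y s) x
      = qpow q ν * A4 q t1 t2 th1 th2 tl1 tl2 ta1 ta2 tb (fun u => Φ x u) s := by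
  have hc := hPc x s hx hs
  have hd := hPd x s hx hs
  have hdiag : qpow q ((h1 + h2 + l1 + l2 + a1 + a2) / 2) * (qpow q (b / 2) + qpow q (-(b / 2)))
      = qpow q (tl1 + tl2 + χ + μ0 + μ0 + a1)
        + qpow q (th1 + th2 + μ0 + μ0 + a1 + ta1 - ta2) := by
    rw [mul_add, ← qpow_add hq0, ← qpow_add hq0]
    congr 2 <;> linarith
  have hdiag' : qpow q ((th1 + th2 + tl1 + tl2 + ta1 + ta2) / 2) *
        (qpow q (tb / 2) + qpow q (-(tb / 2)))
      = qpow q (th1 + th2 + ta1 - χ) + qpow q (tl1 + tl2 + ta2 + χ) := by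
    rw [mul_add, ← qpow_add hq0, ← qpow_add hq0]
    congr 2 <;> linarith
  simp only [A4, hΦ]
  rw [hdiag, hdiag', ofReal_mul_cpow hq0 hx, ofReal_mul_cpow hq0 hs, div_ofReal_cpow hq0 hx,
    div_ofReal_cpow hq0 hs, ← hPa x s hx hs, ← hPb x s hx hs]
  subst hν hμ ha2 hl1 hl2 hh1 hh2
  clear hχ hb hdiag hdiag' hPa hPb hPc hPd hres1 hres2
  simp only [qpow_add hq0, qpow_sub hq0, qpow_neg, qpow_one, ← qpow_half_sq hq0] at hc hd ⊢
  have hr := qpow_ne_zero hq0 (1 / 2)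
  have hC := qpow_ne_zero hq0 χ
  have hk := qpow_ne_zero hq0 a1
  have hT1 := qpow_ne_zero hq0 ta1
  have hT2 := qpow_ne_zero hq0 ta2
  generalize P x (s / qpow q (1 / 2) ^ 2) = Pm at *
  generalize P x (qpow q (1 / 2) ^ 2 * s) = Pp at *
  generalize P x s = p at *
  generalize x ^ ((-a1 : ℝ) : ℂ) = X at *
  generalize s ^ ((1 + χ - ta1 : ℝ) : ℂ) = S at *
  generalize qpow q (1 / 2) = r at *
  generalize qpow q μ0 = A at *
  generalize qpow q χ = C at *
  generalize qpow q a1 = k at *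
  generalize qpow q ta1 = T1 at *
  generalize qpow q ta2 = T2 at *
  generalize qpow q th1 = E1 at *
  generalize qpow q th2 = E2 at *
  generalize qpow q tl1 = L1 at *
  generalize qpow q tl2 = L2 at *
  linear_combination (norm := (field_simp; ring))
    (X * S * k * (1 - A * C * L1 * L2 * t1 * t2 / (x * s))) * hd
    + (X * S * (k * T1 / (T2 * C)) * (1 - A * E1 * E2 * t1 * t2 / (x * s))) * hc
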